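/- Let k ≥ 2, let p_i denote the i-th prime number, and let α, β be integers with Ψ(α, β, 2p_k) ≠ 0. Then Ψ(α, β, 2p_k) divides Ω_0(p_k | α, β | 2p_k) in ℤ, and the product of primes ∏_{i=2}^{k+1} p_i divides the integer quotient Ω_0(p_k | α, β | 2p_k) / Ψ(α, β, 2p_k); equivalently, (∏_{i=2}^{k+1} p_i) · Ψ(α, β, 2p_k) divides Ω_0(p_k | α, β | 2p_k). -/

import Mathlib

/-- The `Ψ` sequence: `Ψ a b 0 = 2`, `Ψ a b 1 = 1`, and
`Ψ a b (m+2) = (2a-b)^(δ(m+1)) * Ψ a b (m+1) - a * Ψ a b m`. -/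
def psiZ (a b : ℤ) : ℕ → ℤ
  | 0 => 2
  | 1 => 1
  | m + 2 => (2 * a - b) ^ ((m + 1) % 2) * psiZ a b (m + 1) - a * psiZ a b m

/-- The Omega sequence `Ω_r(k | ζ, ξ | n)`: `Ω_r(0) = 1` and
`Ω_r(k+1) = (2ζ-ξ)(n-r-(k+1))·Ω_r(k) - 2ζ(n-2r-δ(n-1))·Ω_{r+1}(k)`. -/
def omegaZ (ζ ξ : ℤ) (n : ℕ) : ℕ → ℕ → ℤ
  | _, 0 => 1
  | r, k + 1 =>
    (2 * ζ - ξ) * ((n : ℤ) - r - (k + 1)) * omegaZ ζ ξ n r k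
      - 2 * ζ * ((n : ℤ) - 2 * r - ((n - 1) % 2 : ℕ)) * omegaZ ζ ξ n (r + 1) k

open Finset Nat in
/-- The Omega sequence for even `n`, as a sum over the lattice paths of its recursion. -/
theorem omegaZ_eq_sum_antidiagonal (a b : ℤ) {n : ℕ} (hn : (n - 1) % 2 = 1) (k r : ℕ) :
    omegaZ a b n r k = ∑ ij ∈ antidiagonal k, (k.choose ij.1 : ℤ) *
      (((2 * a - b) ^ ij.1 * ∏ t ∈ range ij.1, ((n : ℤ) - r - k + t)) *
        ((-2 * a) ^ ij.2 * ∏ t ∈ range ij.2, ((n : ℤ) - 2 * r - 1 - 2 * t))) := by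
  induction k generalizing r with
  | zero => simp [omegaZ]
  | succ k ih =>
    rw [sum_antidiagonal_choose_succ_mul (fun i j =>
      (((2 * a - b) ^ i * ∏ t ∈ range i, ((n : ℤ) - r - (k + 1 : ℕ) + t)) *
        ((-2 * a) ^ j * ∏ t ∈ range j, ((n : ℤ) - 2 * r - 1 - 2 * t)))), omegaZ, ih r, ih (r + 1),
      hn, sub_eq_neg_add, ← neg_mul, mul_sum, mul_sum]
    congr 1
    · refine sum_congr rfl fun ij _ => ?_
      rw [prod_range_succ', pow_succ]
      have h₁ : ∀ t ∈ range ij.1, (n : ℤ) - (r + 1 : ℕ) - k + t = n - r - (k + 1 : ℕ) + t := by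
        intro t _; push_cast; ring
      have h₂ : ∀ t ∈ range ij.2,
          (n : ℤ) - 2 * (r + 1 : ℕ) - 1 - 2 * t = n - 2 * r - 1 - 2 * (t + 1 : ℕ) := by
        intro t _; push_cast; ring
      rw [prod_congr rfl h₁, prod_congr rfl h₂]
      push_cast; ring
    · refine sum_congr rfl fun ij hij => ?_
      rw [prod_range_succ', pow_succ]
      have h₁ : ∀ t ∈ range ij.1, (n : ℤ) - r - k + t = n - r - (k + 1 : ℕ) + (t + 1 : ℕ) := by
        intro t _; push_cast; ring
      rw [prod_congr rfl h₁, choose_symm_of_eq_add (HasAntidiagonal.mem_antidiagonal.1 hij).symm]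
      push_cast; ring

open Nat in
/-- The coefficient of `(2a-b)^i (-a)^j` in `Ψ(a, b, 2(i+j))`. -/
def psiEvenCoeff : ℕ → ℕ → ℚ
  | 0, _ => 2
  | i + 1, j => 2 * (i + 1 + j) * (2 * i + j + 1)! / (j ! * (2 * i + 2)!)

open Nat in
/-- The coefficient of `(2a-b)^i (-a)^j` in `Ψ(a, b, 2(i+j)+1)`. -/
def psiOddCoeff (i j : ℕ) : ℚ :=
  (2 * i + 2 * j + 1) * (2 * i + j)! / (j ! * (2 * i + 1)!)

open Nat in
theorem psiOddCoeff_succ_right (i j : ℕ) :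
    psiOddCoeff i (j + 1) = psiEvenCoeff i (j + 1) + psiOddCoeff i j := by
  cases i with
  | zero =>
    simp only [psiOddCoeff, psiEvenCoeff]
    simp [factorial_succ]
    field_simp
    ring
  | succ i =>
    simp only [psiOddCoeff, psiEvenCoeff]
    rw [show 2 * (i + 1) + (j + 1) = 2 * i + j + 1 + 1 + 1 by ring,
      show 2 * (i + 1) + 1 = 2 * i + 2 + 1 by ring, show 2 * (i + 1) + j = 2 * i + j + 1 + 1 by ring,
      show 2 * i + (j + 1) + 1 = 2 * i + j + 1 + 1 by ring]
    rw [factorial_succ (2 * i + j + 1 + 1), factorial_succ (2 * i + 2), factorial_succ j]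
    push_cast
    field_simp
    ring

open Nat in
theorem psiEvenCoeff_succ_succ (i j : ℕ) :
    psiEvenCoeff (i + 1) (j + 1) = psiOddCoeff i (j + 1) + psiEvenCoeff (i + 1) j := by
  simp only [psiOddCoeff, psiEvenCoeff]
  rw [show 2 * i + (j + 1) + 1 = 2 * i + j + 1 + 1 by ring,
    show 2 * i + (j + 1) = 2 * i + j + 1 by ring,
    factorial_succ (2 * i + j + 1), factorial_succ (2 * i + 1), factorial_succ j]
  push_cast
  field_simp
  ring

open Nat in
theorem psiOddCoeff_zero_right (i : ℕ) : psiOddCoeff i 0 = 1 := by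
  simp only [psiOddCoeff, factorial_succ, add_zero, factorial_zero]
  push_cast
  field_simp
  ring

open Nat in
theorem psiEvenCoeff_succ_zero (i : ℕ) : psiEvenCoeff (i + 1) 0 = 1 := by
  simp only [psiEvenCoeff, factorial_succ, add_zero, factorial_zero]
  push_cast
  field_simp
  ring

theorem psiZ_two_mul_add_two (a b : ℤ) (m : ℕ) :
    psiZ a b (2 * m + 2) = (2 * a - b) * psiZ a b (2 * m + 1) - a * psiZ a b (2 * m) := by
  rw [psiZ, show (2 * m + 1) % 2 = 1 by omega, pow_one]

theorem psiZ_two_mul_add_three (a b : ℤ) (m : ℕ) :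
    psiZ a b (2 * m + 3) = psiZ a b (2 * m + 2) - a * psiZ a b (2 * m + 1) := by
  rw [psiZ, show (2 * m + 1 + 1) % 2 = 0 by omega, pow_zero, one_mul]

open Finset in
theorem sum_antidiagonal_psiEvenCoeff_succ (x y : ℚ) (m : ℕ) :
    ∑ ij ∈ antidiagonal (m + 1), psiEvenCoeff ij.1 ij.2 * (x ^ ij.1 * y ^ ij.2) =
      x * ∑ ij ∈ antidiagonal m, psiOddCoeff ij.1 ij.2 * (x ^ ij.1 * y ^ ij.2) +
        y * ∑ ij ∈ antidiagonal m, psiEvenCoeff ij.1 ij.2 * (x ^ ij.1 * y ^ ij.2) := by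
  let f : ℕ → ℕ → ℚ := fun i j => Nat.casesOn i 0 fun i => psiOddCoeff i j
  let g : ℕ → ℕ → ℚ := fun i j => Nat.casesOn j 0 fun j => psiEvenCoeff i j
  have hfg : ∀ ij ∈ antidiagonal (m + 1), psiEvenCoeff ij.1 ij.2 * (x ^ ij.1 * y ^ ij.2) =
      f ij.1 ij.2 * (x ^ ij.1 * y ^ ij.2) + g ij.1 ij.2 * (x ^ ij.1 * y ^ ij.2) := by
    rintro ⟨i, j⟩ hij
    rw [HasAntidiagonal.mem_antidiagonal] at hij
    rw [← add_mul]
    congr 1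
    rcases i with _ | i <;> rcases j with _ | j
    · simp at hij
    · simp [f, g, psiEvenCoeff]
    · simp [f, g, psiEvenCoeff_succ_zero, psiOddCoeff_zero_right]
    · simp [f, g, psiEvenCoeff_succ_succ]
  rw [sum_congr rfl hfg, sum_add_distrib, Nat.sum_antidiagonal_succ, Nat.sum_antidiagonal_succ',
    mul_sum, mul_sum]
  congr 1
  · rw [show f 0 (m + 1) = 0 from rfl, zero_mul, zero_add]
    exact sum_congr rfl fun ij _ => by simp only [f]; ring
  · rw [show g (m + 1) 0 = 0 from rfl, zero_mul, zero_add]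
    exact sum_congr rfl fun ij _ => by simp only [g]; ring

open Finset in
theorem sum_antidiagonal_psiOddCoeff_succ (x y : ℚ) (m : ℕ) :
    ∑ ij ∈ antidiagonal (m + 1), psiOddCoeff ij.1 ij.2 * (x ^ ij.1 * y ^ ij.2) =
      ∑ ij ∈ antidiagonal (m + 1), psiEvenCoeff ij.1 ij.2 * (x ^ ij.1 * y ^ ij.2) +
        y * ∑ ij ∈ antidiagonal m, psiOddCoeff ij.1 ij.2 * (x ^ ij.1 * y ^ ij.2) := by
  rw [Nat.sum_antidiagonal_succ', Nat.sum_antidiagonal_succ', mul_sum, add_assoc,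
    ← sum_add_distrib]
  simp only [psiOddCoeff_zero_right, psiEvenCoeff_succ_zero]
  congr 1
  exact sum_congr rfl fun ij _ => by rw [psiOddCoeff_succ_right]; ring

open Finset in
theorem psiZ_eq_sum_antidiagonal (a b : ℤ) (m : ℕ) :
    (psiZ a b (2 * m) : ℚ) = ∑ ij ∈ antidiagonal m,
        psiEvenCoeff ij.1 ij.2 * ((2 * a - b : ℚ) ^ ij.1 * (-a : ℚ) ^ ij.2) ∧
      (psiZ a b (2 * m + 1) : ℚ) = ∑ ij ∈ antidiagonal m,
        psiOddCoeff ij.1 ij.2 * ((2 * a - b : ℚ) ^ ij.1 * (-a : ℚ) ^ ij.2) := by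
  induction m with
  | zero => simp [psiZ, psiEvenCoeff, psiOddCoeff]
  | succ m ih =>
    have heven : (psiZ a b (2 * m + 2) : ℚ) = ∑ ij ∈ antidiagonal (m + 1),
        psiEvenCoeff ij.1 ij.2 * ((2 * a - b : ℚ) ^ ij.1 * (-a : ℚ) ^ ij.2) := by
      rw [sum_antidiagonal_psiEvenCoeff_succ, ← ih.1, ← ih.2, psiZ_two_mul_add_two]
      push_cast; ring
    refine ⟨heven, ?_⟩
    rw [sum_antidiagonal_psiOddCoeff_succ, ← ih.2, ← heven,
      show 2 * (m + 1) + 1 = 2 * m + 3 by ring, psiZ_two_mul_add_three]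
    push_cast; ring

open Finset Nat in
theorem prod_range_odd_mul_factorial (i j : ℕ) :
    (∏ t ∈ range j, (2 * (i + j : ℕ) - 1 - 2 * t : ℚ)) * (2 ^ j * (2 * i)! * (i + j)!) =
      (2 * (i + j))! * i ! := by
  induction j with
  | zero => simp
  | succ j ih =>
    have h : ∀ t ∈ range j, (2 * (i + (j + 1) : ℕ) - 1 - 2 * (t + 1 : ℕ) : ℚ) =
        2 * (i + j : ℕ) - 1 - 2 * t := by
      intro t _; push_cast; ring
    rw [prod_range_succ', prod_congr rfl h, ← add_assoc, mul_add_one, factorial_succ (i + j),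
      show 2 * (i + j) + 2 = 2 * (i + j) + 1 + 1 from rfl, factorial_succ (2 * (i + j) + 1),
      factorial_succ (2 * (i + j))]
    push_cast at ih ⊢
    linear_combination (2 * (i + j : ℚ) + 1) * 2 * (i + j + 1) * ih

open Finset Nat in
theorem choose_mul_ascFactorial_mul_prod (i j m : ℕ) (hm : m ≠ 0) (hij : i + j = m) :
    (m.choose i : ℚ) * m.ascFactorial i *
        (2 ^ j * ∏ t ∈ range j, (2 * (m : ℕ) - 1 - 2 * t : ℚ)) =
      m.ascFactorial m * psiEvenCoeff i j := by
  obtain ⟨q, rfl⟩ := exists_eq_succ_of_ne_zero hm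
  have hodd := prod_range_odd_mul_factorial i j
  have hchoose : ((i + j).choose i : ℚ) * i ! * j ! = (i + j)! := by
    exact_mod_cast Nat.choose_symm_add (a := i) (b := j) ▸ add_choose_mul_factorial_mul_factorial i j
  have hi : (q ! : ℚ) * (q + 1).ascFactorial i = (q + i)! := by
    exact_mod_cast factorial_mul_ascFactorial q i
  have hq : (q ! : ℚ) * (q + 1).ascFactorial (q + 1) = (q + (q + 1))! := by
    exact_mod_cast factorial_mul_ascFactorial q (q + 1)
  have htwo : ((2 * (i + j))! : ℚ) = 2 * (q + 1) * (q + (q + 1))! := by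
    rw [hij, show 2 * q.succ = q + (q + 1) + 1 by omega, factorial_succ]
    push_cast; ring
  rw [hij] at hodd hchoose htwo
  rw [succ_eq_add_one] at *
  rw [htwo] at hodd
  have hcoeff : psiEvenCoeff i j * (j ! * (2 * i)!) = 2 * (q + 1) * (q + i)! := by
    rcases i with _ | i
    · obtain rfl : j = q + 1 := by omega
      simp [psiEvenCoeff, factorial_succ]
      ring
    · obtain rfl : q = i + j := by omega
      rw [psiEvenCoeff, show 2 * (i + 1) = 2 * i + 2 by ring,
        show i + j + (i + 1) = 2 * i + j + 1 by ring]
      push_cast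
      field_simp
      ring
  set O : ℚ := ∏ t ∈ range j, (2 * ((q + 1 : ℕ) : ℚ) - 1 - 2 * t)
  have hchoose' : ((q + 1).choose i : ℚ) = (q + 1)! / (i ! * j !) := by
    field_simp; linear_combination hchoose
  have hi' : ((q + 1).ascFactorial i : ℚ) = (q + i)! / q ! := by
    field_simp; linear_combination hi
  have hq' : ((q + 1).ascFactorial (q + 1) : ℚ) = (q + (q + 1))! / q ! := by
    field_simp; linear_combination hq
  have hO : 2 ^ j * O = 2 * (q + 1) * (q + (q + 1))! * i ! / ((2 * i)! * (q + 1)!) := by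
    field_simp; linear_combination hodd
  have hcoeff' : psiEvenCoeff i j = 2 * (q + 1) * (q + i)! / (j ! * (2 * i)!) := by
    field_simp; linear_combination hcoeff
  rw [hchoose', hi', hq', hO, hcoeff']
  field_simp

open Finset in
theorem omegaZ_two_mul_eq (a b : ℤ) {m : ℕ} (hm : m ≠ 0) :
    omegaZ a b (2 * m) 0 m = m.ascFactorial m * psiZ a b (2 * m) := by
  have h : (omegaZ a b (2 * m) 0 m : ℚ) = m.ascFactorial m * psiZ a b (2 * m) := by
    rw [omegaZ_eq_sum_antidiagonal a b (by omega), (psiZ_eq_sum_antidiagonal a b m).1, mul_sum]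
    push_cast
    refine sum_congr rfl fun ij hij => ?_
    have hcoeff := choose_mul_ascFactorial_mul_prod ij.1 ij.2 m hm (HasAntidiagonal.mem_antidiagonal.1 hij)
    have hasc : ∏ t ∈ range ij.1, (2 * (m : ℚ) - 0 - m + t) = m.ascFactorial ij.1 := by
      rw [Nat.ascFactorial_eq_prod_range]
      push_cast
      exact prod_congr rfl fun t _ => by ring
    rw [hasc, sub_zero, show (-2 * a : ℚ) = 2 * -a by ring, mul_pow]
    linear_combination ((2 * a - b : ℚ) ^ ij.1 * (-a : ℚ) ^ ij.2) * hcoeff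
  exact_mod_cast h

open Nat in
theorem Nat.Prime.dvd_ascFactorial_self {q m : ℕ} (hq : q.Prime) (hm : m ≠ 0) (hqm : q < 2 * m) :
    q ∣ m.ascFactorial m := by
  rcases le_or_gt q m with h | h
  · exact (hq.dvd_factorial.2 h).trans (factorial_dvd_ascFactorial m m)
  · obtain ⟨s, rfl⟩ := exists_eq_succ_of_ne_zero hm
    have hdvd : q ∣ s ! * (s + 1).ascFactorial (s + 1) := by
      rw [factorial_mul_ascFactorial]
      exact hq.dvd_factorial.2 (by omega)
    exact (hq.dvd_mul.1 hdvd).resolve_left fun hs => by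
      have := hq.dvd_factorial.1 hs
      omega

theorem nth_prime_succ_lt_two_mul (k : ℕ) :
    Nat.nth Nat.Prime (k + 1) < 2 * Nat.nth Nat.Prime k := by
  have hp := Nat.prime_nth_prime k
  obtain ⟨r, hr, hlt, hle⟩ := Nat.exists_prime_lt_and_le_two_mul _ hp.ne_zero
  have hmono := Nat.nth_strictMono Nat.infinite_setOfPred_prime
  rw [← Nat.nth_count hr, hmono.lt_iff_lt] at hlt
  have hnext : Nat.nth Nat.Prime (k + 1) ≤ r := by
    rw [← Nat.nth_count hr]
    exact hmono.monotone hlt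
  refine lt_of_le_of_ne (hnext.trans hle) fun h => ?_
  have hprime := Nat.prime_nth_prime (k + 1)
  rw [h] at hprime
  exact Nat.not_prime_mul (by norm_num) hp.ne_one hprime

theorem prod_nth_prime_dvd_ascFactorial {k : ℕ} (hk : 2 ≤ k) :
    ∏ i ∈ Finset.Icc 2 (k + 1), Nat.nth Nat.Prime (i - 1) ∣
      (Nat.nth Nat.Prime (k - 1)).ascFactorial (Nat.nth Nat.Prime (k - 1)) := by
  have hmono := Nat.nth_strictMono Nat.infinite_setOfPred_prime
  have hinj : Set.InjOn (fun i => Nat.nth Nat.Prime (i - 1)) (Finset.Icc 2 (k + 1)) := by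
    intro i hi j hj hij
    simp only [Finset.coe_Icc, Set.mem_Icc] at hi hj
    have := hmono.injective hij
    omega
  rw [← Finset.prod_image (f := fun q => q) hinj]
  refine Finset.prod_primes_dvd _ (fun q hq => ?_) fun q hq => ?_ <;>
    obtain ⟨i, hi, rfl⟩ := Finset.mem_image.1 hq
  · exact (Nat.prime_nth_prime _).prime
  · rw [Finset.mem_Icc] at hi
    refine (Nat.prime_nth_prime _).dvd_ascFactorial_self (Nat.prime_nth_prime _).ne_zero ?_
    have hlt := nth_prime_succ_lt_two_mul (k - 1)
    exact (hmono.monotone (by omega : i - 1 ≤ k - 1 + 1)).trans_lt hlt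

theorem omega_third_fundamental
    (k : ℕ) (hk : 2 ≤ k) (α β : ℤ)
    (hpsi : psiZ α β (2 * Nat.nth Nat.Prime (k - 1)) ≠ 0) :
    psiZ α β (2 * Nat.nth Nat.Prime (k - 1)) ∣
      omegaZ α β (2 * Nat.nth Nat.Prime (k - 1)) 0 (Nat.nth Nat.Prime (k - 1)) ∧
    (∏ i ∈ Finset.Icc 2 (k + 1), (Nat.nth Nat.Prime (i - 1) : ℤ)) ∣
      omegaZ α β (2 * Nat.nth Nat.Prime (k - 1)) 0 (Nat.nth Nat.Prime (k - 1)) /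
        psiZ α β (2 * Nat.nth Nat.Prime (k - 1)) ∧
    (∏ i ∈ Finset.Icc 2 (k + 1), (Nat.nth Nat.Prime (i - 1) : ℤ)) *
        psiZ α β (2 * Nat.nth Nat.Prime (k - 1)) ∣
      omegaZ α β (2 * Nat.nth Nat.Prime (k - 1)) 0 (Nat.nth Nat.Prime (k - 1)) := by
  have hprod : (∏ i ∈ Finset.Icc 2 (k + 1), (Nat.nth Nat.Prime (i - 1) : ℤ)) ∣
      ((Nat.nth Nat.Prime (k - 1)).ascFactorial (Nat.nth Nat.Prime (k - 1)) : ℤ) := by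
    exact_mod_cast prod_nth_prime_dvd_ascFactorial hk
  rw [omegaZ_two_mul_eq α β (Nat.prime_nth_prime _).ne_zero]
  refine ⟨dvd_mul_left _ _, ?_, mul_dvd_mul_right hprod _⟩
  rwa [Int.mul_ediv_cancel _ hpsi]
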